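/- Let G be a 3-connected 1-heavy graph on n vertices. If for every pair of vertices u, v with distance 2 in G, either max{deg(u), deg(v)} ≥ n/2 or |N(u) ∩ N(v)| ≥ 2, then G is Hamiltonian. -/

import Mathlib

open SimpleGraph

/-- `G` is 2-connected: at least 3 vertices and deleting any single vertex leaves
a connected graph. -/
def TwoConnected {V : Type*} [Fintype V] (G : SimpleGraph V) : Prop :=
  3 ≤ Fintype.card V ∧ ∀ v : V, (G.induce {w | w ≠ v}).Connected

/-- `c, a, b, d` form an induced claw (`K_{1,3}`) in `G` with center `c` and
end-vertices `a`, `b`, `d`. -/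
def IsInducedClaw {V : Type*} (G : SimpleGraph V) (c a b d : V) : Prop :=
  a ≠ b ∧ a ≠ d ∧ b ≠ d ∧
  G.Adj c a ∧ G.Adj c b ∧ G.Adj c d ∧
  ¬G.Adj a b ∧ ¬G.Adj a d ∧ ¬G.Adj b d

/-- `a₁, a₂, a₃, b₁` form an induced copy of `Z₁` in `G`: triangle `a₁a₂a₃` with
pendant edge `a₁b₁`. -/
def IsInducedZ1 {V : Type*} (G : SimpleGraph V) (a1 a2 a3 b1 : V) : Prop :=
  G.Adj a1 a2 ∧ G.Adj a1 a3 ∧ G.Adj a2 a3 ∧ G.Adj a1 b1 ∧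
  b1 ≠ a2 ∧ b1 ≠ a3 ∧ ¬G.Adj b1 a2 ∧ ¬G.Adj b1 a3

/-- `a₁, a₂, a₃, b₁, c₁` form an induced copy of `Z₂` in `G`: triangle `a₁a₂a₃`
with path `a₁b₁c₁` attached at `a₁`. -/
def IsInducedZ2 {V : Type*} (G : SimpleGraph V) (a1 a2 a3 b1 c1 : V) : Prop :=
  G.Adj a1 a2 ∧ G.Adj a1 a3 ∧ G.Adj a2 a3 ∧ G.Adj a1 b1 ∧ G.Adj b1 c1 ∧
  b1 ≠ a2 ∧ b1 ≠ a3 ∧ c1 ≠ a1 ∧ c1 ≠ a2 ∧ c1 ≠ a3 ∧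
  ¬G.Adj b1 a2 ∧ ¬G.Adj b1 a3 ∧ ¬G.Adj c1 a1 ∧ ¬G.Adj c1 a2 ∧ ¬G.Adj c1 a3
/-- A vertex is heavy if its degree is at least `n/2`. -/
def Heavy {V : Type*} [Fintype V] (G : SimpleGraph V) [DecidableRel G.Adj] (v : V) : Prop :=
  Fintype.card V ≤ 2 * G.degree v

/-- `G` is 1-heavy: every induced claw has at least one heavy end-vertex. -/
def OneHeavy {V : Type*} [Fintype V] (G : SimpleGraph V) [DecidableRel G.Adj] : Prop :=
  ∀ c a b d : V, IsInducedClaw G c a b d → Heavy G a ∨ Heavy G b ∨ Heavy G d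

/-- `G` is 2-heavy: every induced claw has at least two heavy end-vertices. -/
def TwoHeavy {V : Type*} [Fintype V] (G : SimpleGraph V) [DecidableRel G.Adj] : Prop :=
  ∀ c a b d : V, IsInducedClaw G c a b d →
    (Heavy G a ∧ Heavy G b) ∨ (Heavy G a ∧ Heavy G d) ∨ (Heavy G b ∧ Heavy G d)

/-- `G` is o-heavy: every induced claw has two end-vertices with degree sum
at least `n`. -/
def OHeavy {V : Type*} [Fintype V] (G : SimpleGraph V) [DecidableRel G.Adj] : Prop :=
  ∀ c a b d : V, IsInducedClaw G c a b d →
    Fintype.card V ≤ G.degree a + G.degree b ∨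
    Fintype.card V ≤ G.degree a + G.degree d ∨
    Fintype.card V ≤ G.degree b + G.degree d

/-- The pair `u, v` satisfies Fan's condition (`max{d(u),d(v)} ≥ n/2`) or Shi's
condition (`|N(u) ∩ N(v)| ≥ 2`). -/
def FanOrShi {V : Type*} [Fintype V] [DecidableEq V]
    (G : SimpleGraph V) [DecidableRel G.Adj] (u v : V) : Prop :=
  Fintype.card V ≤ 2 * G.degree u ∨ Fintype.card V ≤ 2 * G.degree v ∨
  2 ≤ (G.neighborFinset u ∩ G.neighborFinset v).card
/-- `G` is 3-connected: at least 4 vertices and deleting any two (not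
necessarily distinct) vertices leaves a connected graph. -/
def ThreeConnected {V : Type*} [Fintype V] (G : SimpleGraph V) : Prop :=
  4 ≤ Fintype.card V ∧ ∀ u v : V, (G.induce {w | w ≠ u ∧ w ≠ v}).Connected

/-- `PathOn G S u v`: the graph `G` has a path from `u` to `v` with vertex set exactly `S`. -/
inductive PathOn {V : Type*} [DecidableEq V] (G : SimpleGraph V) : Finset V → V → V → Prop
  | single (v : V) : PathOn G {v} v v
  | cons {u v w : V} {S : Finset V} (huv : G.Adj u v) (hu : u ∉ S) (h : PathOn G S v w) :
      PathOn G (insert u S) u w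

namespace PathOn

variable {V : Type*} [DecidableEq V] {G : SimpleGraph V}

theorem append {S T : Finset V} {u v w x : V} (h₁ : PathOn G S u v) (hvw : G.Adj v w)
    (h₂ : PathOn G T w x) (hd : Disjoint S T) : PathOn G (S ∪ T) u x := by
  induction h₁ with
  | single v =>
    rw [← Finset.insert_eq]
    exact cons hvw (by simpa using hd) h₂
  | cons huv hu h ih =>
    rw [Finset.disjoint_insert_left] at hd
    rw [Finset.insert_union]
    exact cons huv (by simp [hu, hd.1]) (ih hvw hd.2)

theorem symm {S : Finset V} {u v : V} (h : PathOn G S u v) : PathOn G S v u := by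
  induction h with
  | single v => exact single v
  | @cons u v w S huv hu h ih =>
    rw [Finset.insert_eq, Finset.union_comm]
    exact ih.append huv.symm (single u) (by simpa using hu)

theorem left_mem {S : Finset V} {u v : V} (h : PathOn G S u v) : u ∈ S := by
  cases h <;> simp

theorem of_isPath {u v : V} {p : G.Walk u v} (hp : p.IsPath) :
    PathOn G p.support.toFinset u v := by
  induction p with
  | nil => simpa using single _
  | cons h p ih =>
    rw [SimpleGraph.Walk.cons_isPath_iff] at hp
    simpa using cons h (by simpa using hp.2) (ih hp.1)

theorem exists_of_reachable_induce {s : Set V} {a b : s} (h : (G.induce s).Reachable a b) :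
    ∃ S, PathOn G S a b ∧ ∀ x ∈ S, x ∈ s := by
  obtain ⟨p, hp⟩ := h.exists_isPath
  have hq := hp.map (f := (Embedding.induce (G := G) s).toHom) Subtype.val_injective
  refine ⟨_, of_isPath hq, ?_⟩
  intro x hx
  have hx' : x ∈ (p.map (Embedding.induce (G := G) s).toHom).support := List.mem_toFinset.1 hx
  rw [Walk.support_map, List.mem_map] at hx'
  obtain ⟨y, -, rfl⟩ := hx'
  exact y.2

/-- The vertices of a path can be listed in order by the integers `0, …, |S| - 1`. -/
theorem exists_index {S : Finset V} {u v : V} (h : PathOn G S u v) :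
    ∃ c : ℤ → V, c 0 = u ∧ c (S.card - 1) = v ∧
      (∀ i : ℤ, 0 ≤ i → i < S.card - 1 → G.Adj (c i) (c (i + 1))) ∧
      (∀ i j : ℤ, 0 ≤ i → i < S.card → 0 ≤ j → j < S.card → c i = c j → i = j) ∧
      ∀ x, x ∈ S ↔ ∃ i : ℤ, 0 ≤ i ∧ i < S.card ∧ c i = x := by
  induction h with
  | single v =>
    refine ⟨fun _ => v, rfl, rfl, fun i h0 h1 => ?_, fun i j _ _ _ _ _ => ?_, fun x => ?_⟩
    · simp at h1; omega
    · simp only [Finset.card_singleton, Nat.cast_one] at *; omega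
    · simp only [Finset.mem_singleton, Finset.card_singleton]
      exact ⟨fun hx => ⟨0, by simp, by simp, hx.symm⟩, fun ⟨_, _, _, hx⟩ => hx.symm⟩
  | @cons u v w S huv hu h ih =>
    obtain ⟨c, h0, h1, hadj, hinj, hmem⟩ := ih
    have hpos : 0 < S.card := Finset.card_pos.2 ⟨_, h.left_mem⟩
    have hnot : ∀ i : ℤ, 0 ≤ i → i < S.card → c i ≠ u := fun i hi hi' hc =>
      hu ((hmem u).2 ⟨i, hi, hi', hc⟩)
    rw [Finset.card_insert_of_notMem hu]
    push_cast
    refine ⟨fun i => if i ≤ 0 then u else c (i - 1), by simp, ?_, fun i hi hi' => ?_,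
      fun i j hi hi' hj hj' hij => ?_, fun x => ?_⟩
    · simp only
      rw [if_neg (by omega), ← h1]
      congr 1; ring
    · rcases hi.eq_or_lt with rfl | hi0
      · simpa [h0] using huv
      · simp only
        rw [if_neg (by omega), if_neg (by omega)]
        have := hadj (i - 1) (by omega) (by omega)
        rwa [show i - 1 + 1 = i + 1 - 1 by ring] at this
    · simp only at hij
      split_ifs at hij with h2 h3 h3
      · omega
      · exact absurd hij.symm (hnot _ (by omega) (by omega))
      · exact absurd hij (hnot _ (by omega) (by omega))
      · have := hinj _ _ (by omega) (by omega) (by omega) (by omega) hij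
        omega
    · rw [Finset.mem_insert, hmem]
      constructor
      · rintro (rfl | ⟨i, hi, hi', rfl⟩)
        · exact ⟨0, le_rfl, by omega, by simp⟩
        · exact ⟨i + 1, by omega, by omega, by simp only; rw [if_neg (by omega)]; simp⟩
      · rintro ⟨i, hi, hi', hx⟩
        simp only at hx
        split_ifs at hx with h2
        · exact Or.inl hx.symm
        · exact Or.inr ⟨i - 1, by omega, by omega, hx⟩

theorem of_index {c : ℤ → V} {i j : ℤ} (hij : i ≤ j)
    (hadj : ∀ k, i ≤ k → k < j → G.Adj (c k) (c (k + 1)))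
    (hinj : ∀ k l, i ≤ k → k ≤ j → i ≤ l → l ≤ j → c k = c l → k = l) :
    PathOn G ((Finset.Icc i j).image c) (c i) (c j) := by
  induction j, hij using Int.leInduction with
  | base => simpa using single (c i)
  | succ j hij ih =>
    have h₁ := ih (fun k hk hk' => hadj k hk (by omega))
      (fun k l hk hk' hl hl' => hinj k l hk (by omega) hl (by omega))
    have h₂ := h₁.append (hadj j hij (by omega)) (single (c (j + 1))) (by
      simp only [Finset.disjoint_singleton_right, Finset.mem_image, Finset.mem_Icc, not_exists]
      rintro k ⟨⟨hk, hk'⟩, hc⟩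
      have := hinj k (j + 1) hk (by omega) (by omega) le_rfl hc
      omega)
    convert h₂ using 1
    ext x
    simp only [Finset.mem_image, Finset.mem_Icc, Finset.mem_union, Finset.mem_singleton]
    constructor
    · rintro ⟨k, ⟨hk, hk'⟩, rfl⟩
      rcases hk'.lt_or_eq with h | rfl
      · exact Or.inl ⟨k, ⟨hk, by omega⟩, rfl⟩
      · exact Or.inr rfl
    · rintro (⟨k, ⟨hk, hk'⟩, rfl⟩ | rfl)
      · exact ⟨k, ⟨hk, by omega⟩, rfl⟩
      · exact ⟨j + 1, ⟨by omega, le_rfl⟩, rfl⟩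

theorem exists_isPath {S : Finset V} {u v : V} (h : PathOn G S u v) :
    ∃ p : G.Walk u v, p.IsPath ∧ p.support.toFinset = S := by
  induction h with
  | single v => exact ⟨.nil, by simp, by simp⟩
  | cons huv hu h ih =>
    obtain ⟨p, hp, rfl⟩ := ih
    exact ⟨.cons huv p, by rw [SimpleGraph.Walk.cons_isPath_iff]; exact ⟨hp, by simpa using hu⟩, by simp⟩

end PathOn

/-- `c` runs periodically, with period `m`, through the vertices of a cycle of length `m`. -/
structure CycleIndex {V : Type*} (G : SimpleGraph V) (c : ℤ → V) (m : ℤ) : Prop where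
  three_le : 3 ≤ m
  adj : ∀ i, G.Adj (c i) (c (i + 1))
  eq_iff : ∀ i j, c i = c j ↔ m ∣ i - j

namespace CycleIndex

variable {V : Type*} {G : SimpleGraph V} {c : ℤ → V} {m : ℤ}

theorem exists_eq_of_window (hc : CycleIndex G c m) (s k : ℤ) :
    ∃ l, s ≤ l ∧ l < s + m ∧ ∀ d, c (l + d) = c (k + d) := by
  have hm := hc.three_le
  refine ⟨s + (k - s) % m, ?_, ?_, fun d => ?_⟩
  · have := Int.emod_nonneg (k - s) (by omega : m ≠ 0); omega
  · have := Int.emod_lt_of_pos (k - s) (by omega : 0 < m); omega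
  · rw [hc.eq_iff]
    refine ⟨-((k - s) / m), ?_⟩
    have := Int.emod_add_mul_ediv (k - s) m
    linear_combination this

theorem forall_of_window (hc : CycleIndex G c m) {p : V → Prop} (s : ℤ)
    (h : ∀ k, s ≤ k → k < s + m → p (c k)) (k : ℤ) : p (c k) := by
  obtain ⟨l, hl, hl', he⟩ := hc.exists_eq_of_window s k
  have := he 0
  simp only [add_zero] at this
  exact this ▸ h l hl hl'

theorem ne_of_lt (hc : CycleIndex G c m) {i j : ℤ} (hij : i < j) (hj : j < i + m) :
    c i ≠ c j := by
  intro h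
  have h' := (hc.eq_iff _ _).1 h.symm
  have := Int.le_of_dvd (by omega) h'
  omega

theorem add_period (hc : CycleIndex G c m) (i : ℤ) : c (i + m) = c i :=
  (hc.eq_iff _ _).2 ⟨1, by ring⟩

variable [DecidableEq V]

theorem pathOn (hc : CycleIndex G c m) {i j : ℤ} (hij : i ≤ j) (hj : j < i + m) :
    PathOn G ((Finset.Icc i j).image c) (c i) (c j) := by
  refine PathOn.of_index hij (fun k _ _ => hc.adj k) fun k l hk hk' hl hl' h => ?_
  rcases lt_trichotomy k l with hkl | hkl | hkl
  · exact absurd h (hc.ne_of_lt hkl (by omega))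
  · exact hkl
  · exact absurd h.symm (hc.ne_of_lt hkl (by omega))

theorem disjoint_image (hc : CycleIndex G c m) {i j k l s : ℤ} (hi : s ≤ i) (hj : j < s + m)
    (hk : s ≤ k) (hl : l < s + m) (h : j < k ∨ l < i) :
    Disjoint ((Finset.Icc i j).image c) ((Finset.Icc k l).image c) := by
  rw [Finset.disjoint_left]
  simp only [Finset.mem_image, Finset.mem_Icc]
  rintro x ⟨p, hp, rfl⟩ ⟨q, hq, hpq⟩
  rcases h with h | h
  · exact hc.ne_of_lt (i := p) (j := q) (by omega) (by omega) hpq.symm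
  · exact hc.ne_of_lt (i := q) (j := p) (by omega) (by omega) hpq

theorem of_pathOn {S : Finset V} {u v : V} (h : PathOn G S u v) (hvu : G.Adj v u)
    (hS : 3 ≤ S.card) :
    ∃ c : ℤ → V, CycleIndex G c (S.card : ℤ) ∧ ∀ x, x ∈ S ↔ ∃ i, c i = x := by
  obtain ⟨f, h0, h1, hadj, hinj, hmem⟩ := h.exists_index
  set m : ℤ := (S.card : ℤ) with hm
  have hm3 : 3 ≤ m := by omega
  have hnn : ∀ i : ℤ, 0 ≤ i % m := fun i => Int.emod_nonneg i (by omega)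
  have hlt : ∀ i : ℤ, i % m < m := fun i => Int.emod_lt_of_pos i (by omega)
  refine ⟨fun i => f (i % m), ⟨hm3, fun i => ?_, fun i j => ?_⟩, fun x => ?_⟩
  · by_cases hi : i % m = m - 1
    · have : (i + 1) % m = 0 := by
        rw [Int.add_emod, hi, Int.emod_eq_of_lt (a := 1) (by omega) (by omega)]
        simp
      rwa [hi, this, h0, h1]
    · have hs : (i + 1) % m = i % m + 1 := by
        rw [Int.add_emod, Int.emod_eq_of_lt (a := 1) (by omega) (by omega)]
        exact Int.emod_eq_of_lt (by have := hnn i; omega) (by have := hlt i; omega)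
      rw [hs]
      exact hadj _ (hnn i) (by have := hlt i; omega)
  · rw [Int.dvd_iff_emod_eq_zero, ← Int.emod_eq_emod_iff_emod_sub_eq_zero]
    exact ⟨fun h => hinj _ _ (hnn i) (hlt i) (hnn j) (hlt j) h, congrArg f⟩
  · rw [hmem]
    constructor
    · rintro ⟨i, hi, hi', rfl⟩
      exact ⟨i, by simp only [Int.emod_eq_of_lt hi hi']⟩
    · rintro ⟨i, rfl⟩
      exact ⟨_, hnn i, hlt i, rfl⟩

end CycleIndex

/-- `G` has a spanning path whose ends are adjacent. -/
def HasSpanningCycle {V : Type*} [Fintype V] [DecidableEq V] (G : SimpleGraph V) : Prop :=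
  ∃ u v, PathOn G Finset.univ u v ∧ G.Adj v u

namespace HasSpanningCycle

variable {V : Type*} [Fintype V] [DecidableEq V] {G : SimpleGraph V}

theorem isHamiltonian (h : HasSpanningCycle G) (hV : 3 ≤ Fintype.card V) : G.IsHamiltonian := by
  intro _
  obtain ⟨u, v, h, hvu⟩ := h
  obtain ⟨p, hp, hS⟩ := h.exists_isPath
  have hH : p.IsHamiltonian := by
    rw [hp.isHamiltonian_iff]
    intro w
    simp [← List.mem_toFinset, hS]
  refine ⟨v, .cons hvu p, ?_⟩
  have hlen := hH.length_eq
  rw [Walk.isHamiltonianCycle_iff_isCycle_and_length_eq, Walk.isCycle_iff_isPath_tail_and_le_length]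
  exact ⟨⟨by simpa using hp, by simp; omega⟩, by simp; omega⟩

/-- Ore's crossing argument. -/
theorem of_pathOn {s t : Finset V} {u v : V} (h : PathOn G Finset.univ u v)
    (hs : ∀ x ∈ s, G.Adj u x) (ht : ∀ x ∈ t, G.Adj v x) (hst : Fintype.card V ≤ s.card + t.card) :
    HasSpanningCycle G := by
  classical
  obtain ⟨c, h0, h1, hadj, hinj, hmem⟩ := h.exists_index
  rw [Finset.card_univ] at h1 hadj hinj hmem
  set n : ℤ := (Fintype.card V : ℤ) with hn
  have hn0 : 0 < n := by
    rw [hn, Nat.cast_pos]; exact Fintype.card_pos_iff.2 ⟨u⟩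
  set A := (Finset.Ico (0 : ℤ) (n - 1)).filter fun i => c (i + 1) ∈ s with hA
  set B := (Finset.Ico (0 : ℤ) (n - 1)).filter fun i => c i ∈ t with hB
  have hAs : s.card ≤ A.card := by
    refine le_trans (Finset.card_le_card ?_) (Finset.card_image_le (f := fun i => c (i + 1)))
    intro x hx
    obtain ⟨i, hi, hi', rfl⟩ := (hmem x).1 (Finset.mem_univ x)
    have : i ≠ 0 := by
      rintro rfl
      exact (hs _ hx).ne h0.symm
    rw [Finset.mem_image]
    exact ⟨i - 1, by simp [hA, hx]; omega, by simp⟩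
  have hBt : t.card ≤ B.card := by
    refine le_trans (Finset.card_le_card ?_) (Finset.card_image_le (f := c))
    intro x hx
    obtain ⟨i, hi, hi', rfl⟩ := (hmem x).1 (Finset.mem_univ x)
    have : i ≠ n - 1 := by
      rintro rfl
      exact (ht _ hx).ne h1.symm
    rw [Finset.mem_image]
    exact ⟨i, by simp [hB, hx]; omega, rfl⟩
  have hAB : (A ∩ B).Nonempty := by
    rw [← Finset.card_pos]
    have h2 := Finset.card_union_add_card_inter A B
    have h3 : (A ∪ B).card ≤ (Finset.Ico (0 : ℤ) (n - 1)).card :=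
      Finset.card_le_card (Finset.union_subset (Finset.filter_subset _ _)
        (Finset.filter_subset _ _))
    rw [Int.card_Ico] at h3
    omega
  obtain ⟨i, hi⟩ := hAB
  simp only [hA, hB, Finset.mem_inter, Finset.mem_filter, Finset.mem_Ico] at hi
  obtain ⟨⟨⟨hi0, hin⟩, his⟩, -, hit⟩ := hi
  have p₁ := PathOn.of_index (G := G) (c := c) hi0 (fun k _ _ => hadj k (by omega) (by omega))
    (fun k l _ _ _ _ => hinj k l (by omega) (by omega) (by omega) (by omega))
  have p₂ := PathOn.of_index (G := G) (c := c) (i := i + 1) (j := n - 1) (by omega)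
    (fun k _ _ => hadj k (by omega) (by omega))
    (fun k l _ _ _ _ => hinj k l (by omega) (by omega) (by omega) (by omega))
  refine ⟨c 0, c (i + 1), ?_, ?_⟩
  · convert p₁.append (by rw [h1]; exact (ht _ hit).symm) p₂.symm ?_ using 1
    · ext x
      obtain ⟨k, hk, hk', rfl⟩ := (hmem x).1 (Finset.mem_univ x)
      simp only [Finset.mem_univ, Finset.mem_union, Finset.mem_image, Finset.mem_Icc, true_iff]
      by_cases hki : k ≤ i
      · exact Or.inl ⟨k, by omega, rfl⟩
      · exact Or.inr ⟨k, by omega, rfl⟩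
    · rw [Finset.disjoint_left]
      simp only [Finset.mem_image, Finset.mem_Icc]
      rintro x ⟨p, hp, rfl⟩ ⟨q, hq, hpq⟩
      have := hinj q p (by omega) (by omega) (by omega) (by omega) hpq
      omega
  · rw [h0]; exact (hs _ his).symm

theorem of_sup_edge {s t : Finset V} {u v : V} (hV : 3 ≤ Fintype.card V)
    (hs : ∀ x ∈ s, G.Adj u x) (ht : ∀ x ∈ t, G.Adj v x) (hst : Fintype.card V ≤ s.card + t.card)
    (h : HasSpanningCycle (G ⊔ edge u v)) : HasSpanningCycle G := by
  obtain ⟨a, b, hab, hba⟩ := h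
  obtain ⟨c, hc, hmem⟩ := CycleIndex.of_pathOn hab hba (by simpa using hV)
  rw [Finset.card_univ] at hc
  have huniv : ∀ i : ℤ, Finset.univ = (Finset.Icc (i + 1) (i + Fintype.card V)).image c := by
    intro i
    symm
    rw [Finset.eq_univ_iff_forall]
    intro x
    obtain ⟨k, rfl⟩ := (hmem x).1 (Finset.mem_univ x)
    obtain ⟨l, hl, hl', h⟩ := hc.exists_eq_of_window (i + 1) k
    exact Finset.mem_image.2 ⟨l, by simp; omega, by simpa using h 0⟩
  have hedge : ∀ x y, (edge u v).Adj x y → x = u ∧ y = v ∨ x = v ∧ y = u := by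
    intro x y hxy
    rw [edge_adj] at hxy
    tauto
  have hpath : ∀ i : ℤ, (∀ k : ℤ, i + 1 ≤ k → k < i + Fintype.card V → G.Adj (c k) (c (k + 1))) →
      PathOn G Finset.univ (c (i + 1)) (c i) := by
    intro i hi
    rw [huniv i, ← hc.add_period i]
    refine PathOn.of_index (by omega) hi fun k l hk hk' hl hl' hkl => ?_
    rcases lt_trichotomy k l with h | h | h
    · exact absurd hkl (hc.ne_of_lt h (by omega))
    · exact h
    · exact absurd hkl.symm (hc.ne_of_lt h (by omega))
  by_cases hall : ∀ i, G.Adj (c i) (c (i + 1))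
  · exact ⟨_, _, hpath 0 fun k _ _ => hall k, hall 0⟩
  · push Not at hall
    obtain ⟨i, hi⟩ := hall
    have hi' := hedge _ _ ((hc.adj i).resolve_left hi)
    have p := hpath i fun k hk hk' => by
      by_contra hk2
      have hk3 := hedge _ _ ((hc.adj k).resolve_left hk2)
      have h1 : c i ≠ c k := hc.ne_of_lt (by omega) (by omega)
      have h2 : c k = c (i + 1) ∧ c (k + 1) = c i := by
        rcases hi' with ⟨e1, e2⟩ | ⟨e1, e2⟩ <;> rcases hk3 with ⟨e3, e4⟩ | ⟨e3, e4⟩ <;>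
          simp_all
      have h3 : k = i + 1 := by
        by_contra hne
        exact hc.ne_of_lt (i := i + 1) (j := k) (by omega) (by omega) h2.1.symm
      subst h3
      exact hc.ne_of_lt (i := i) (j := i + 1 + 1) (by omega) (by omega) h2.2.symm
    rcases hi' with ⟨e1, e2⟩ | ⟨e1, e2⟩ <;> rw [e1, e2] at p
    · exact of_pathOn p.symm hs ht hst
    · exact of_pathOn p hs ht hst

/-- Bondy–Chvátal: joining nonadjacent vertices whose degree sum is at least the number of
vertices does not affect Hamiltonicity. -/
theorem of_le {G' : SimpleGraph V} [DecidableRel G.Adj] (hV : 3 ≤ Fintype.card V) (hle : G ≤ G')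
    (hdeg : ∀ u v, G'.Adj u v → ¬ G.Adj u v → Fintype.card V ≤ G.degree u + G.degree v)
    (h : HasSpanningCycle G') : HasSpanningCycle G := by
  by_contra hG
  obtain ⟨K, hK⟩ := Set.Finite.exists_maximal
    (s := {K : SimpleGraph V | G ≤ K ∧ K ≤ G' ∧ ¬ HasSpanningCycle K}) (Set.toFinite _)
    ⟨G, le_rfl, hle, hG⟩
  obtain ⟨hGK, hKG', hKn⟩ := hK.prop
  have hne : ¬ G' ≤ K := fun h' => hKn (le_antisymm hKG' h' ▸ h)
  simp only [SimpleGraph.le_iff_adj, not_forall] at hne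
  obtain ⟨u, v, huv, hKuv⟩ := hne
  refine hKn (of_sup_edge hV (s := G.neighborFinset u) (t := G.neighborFinset v)
    (fun x hx => hGK (by simpa using hx)) (fun x hx => hGK (by simpa using hx))
    (by simpa using hdeg u v huv fun h' => hKuv (hGK h')) ?_)
  by_contra hn
  have hle' := hK.le_of_ge (y := K ⊔ edge u v)
    ⟨hGK.trans le_sup_left, sup_le hKG' ?_, hn⟩ le_sup_left
  · exact hKuv (hle' (Or.inr (by simp [edge_adj, huv.ne])))
  · intro x y hxy
    rw [edge_adj] at hxy
    rcases hxy.1 with ⟨rfl, rfl⟩ | ⟨rfl, rfl⟩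
    · exact huv
    · exact huv.symm

end HasSpanningCycle

/-- `G` contains no cycle whose vertex set strictly contains the set of values of `c`. -/
def IsMaximalCycle {V : Type*} [DecidableEq V] (G : SimpleGraph V) (c : ℤ → V) : Prop :=
  ∀ (S : Finset V) (u v : V), PathOn G S u v → G.Adj v u → (∀ k, c k ∈ S) → ∀ x ∈ S, ∃ k, c k = x

/-- There is a path from `u` to `v` with at least one inner vertex, all of whose inner vertices
avoid `c`. -/
def Bridge {V : Type*} [DecidableEq V] (G : SimpleGraph V) (c : ℤ → V) (u v : V) : Prop :=
  ∃ (S : Finset V) (p q : V), PathOn G S p q ∧ (∀ x ∈ S, ∀ k, c k ≠ x) ∧ G.Adj u p ∧ G.Adj q v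

section Rerouting

variable {V : Type*} [DecidableEq V] {G : SimpleGraph V} {c : ℤ → V} {m : ℤ}

theorem IsMaximalCycle.not_bridge (hmax : IsMaximalCycle G c) {S : Finset V} {u v : V}
    (h : PathOn G S u v) (hS : ∀ x ∈ S, ∃ k, c k = x) (hall : ∀ k, c k ∈ S) :
    ¬ Bridge G c u v := by
  rintro ⟨T, p, q, hT, hoff, hup, hqv⟩
  have hd : Disjoint S T := by
    rw [Finset.disjoint_left]
    intro x hx hx'
    obtain ⟨k, hk⟩ := hS x hx
    exact hoff x hx' k hk
  obtain ⟨k, hk⟩ := hmax _ _ _ (h.symm.append hup hT hd) hqv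
    (fun k => Finset.mem_union_left _ (hall k)) p (Finset.mem_union_right _ hT.left_mem)
  exact hoff p hT.left_mem k hk

namespace CycleIndex

theorem not_bridge_succ (hc : CycleIndex G c m) (hmax : IsMaximalCycle G c) (i : ℤ) :
    ¬ Bridge G c (c (i + 1)) (c i) := by
  have hm := hc.three_le
  rw [← hc.add_period i]
  refine hmax.not_bridge (hc.pathOn (by omega) (by omega)) ?_ (hc.forall_of_window (p := fun x => x ∈ _) (i + 1) ?_)
  · intro x hx
    obtain ⟨k, -, rfl⟩ := Finset.mem_image.1 hx
    exact ⟨k, rfl⟩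
  · exact fun k hk hk' => Finset.mem_image.2 ⟨k, by simp; omega, rfl⟩

theorem not_adj_succ_of_bridge (hc : CycleIndex G c m) (hmax : IsMaximalCycle G c) {i j : ℤ}
    (hij : i < j) (hj : j < i + m) (hb : Bridge G c (c j) (c i)) :
    ¬ G.Adj (c (i + 1)) (c (j + 1)) := by
  intro hadj
  rw [← hc.add_period i] at hb
  refine hmax.not_bridge ((hc.pathOn (i := i + 1) (j := j) (by omega) (by omega)).symm.append hadj
    (hc.pathOn (i := j + 1) (j := i + m) (by omega) (by omega))
    (hc.disjoint_image (s := i + 1) (by omega) (by omega) (by omega) (by omega) (by omega)))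
    ?_ (hc.forall_of_window (p := fun x => x ∈ _) (i + 1) fun k hk hk' => ?_) hb
  · intro x hx
    simp only [Finset.mem_union, Finset.mem_image] at hx
    rcases hx with ⟨k, -, rfl⟩ | ⟨k, -, rfl⟩ <;> exact ⟨k, rfl⟩
  · simp only [Finset.mem_union, Finset.mem_image, Finset.mem_Icc]
    by_cases h : k ≤ j
    · exact Or.inl ⟨k, by omega, rfl⟩
    · exact Or.inr ⟨k, by omega, rfl⟩

theorem not_adj_pred_of_bridge (hc : CycleIndex G c m) (hmax : IsMaximalCycle G c) {i j : ℤ}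
    (hij : i < j) (hj : j < i + m) (hb : Bridge G c (c j) (c i)) :
    ¬ G.Adj (c (i - 1)) (c (j - 1)) := by
  intro hadj
  rw [← hc.add_period (i - 1)] at hadj
  refine hmax.not_bridge ((hc.pathOn (i := j) (j := i - 1 + m) (by omega) (by omega)).append hadj
    (hc.pathOn (i := i) (j := j - 1) (by omega) (by omega)).symm
    (hc.disjoint_image (s := i) (by omega) (by omega) (by omega) (by omega) (by omega)))
    ?_ (hc.forall_of_window (p := fun x => x ∈ _) i fun k hk hk' => ?_) hb
  · intro x hx
    simp only [Finset.mem_union, Finset.mem_image] at hx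
    rcases hx with ⟨k, -, rfl⟩ | ⟨k, -, rfl⟩ <;> exact ⟨k, rfl⟩
  · simp only [Finset.mem_union, Finset.mem_image, Finset.mem_Icc]
    by_cases h : k < j
    · exact Or.inr ⟨k, by omega, rfl⟩
    · exact Or.inl ⟨k, by omega, rfl⟩

/-- Three disjoint paths that together cover the vertices of a maximal cycle cannot be linked up
to a path whose ends are joined by a bridge. -/
theorem not_bridge_of_three_paths (hc : CycleIndex G c m) (hmax : IsMaximalCycle G c)
    {i₁ j₁ i₂ j₂ i₃ j₃ s : ℤ} {a₁ b₁ a₂ b₂ a₃ b₃ : V}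
    (h₁ : PathOn G ((Finset.Icc i₁ j₁).image c) a₁ b₁)
    (h₂ : PathOn G ((Finset.Icc i₂ j₂).image c) a₂ b₂)
    (h₃ : PathOn G ((Finset.Icc i₃ j₃).image c) a₃ b₃)
    (h₁₂ : G.Adj b₁ a₂) (h₂₃ : G.Adj b₂ a₃)
    (hw : s ≤ i₁ ∧ j₁ < s + m ∧ s ≤ i₂ ∧ j₂ < s + m ∧ s ≤ i₃ ∧ j₃ < s + m)
    (d₁₂ : j₁ < i₂ ∨ j₂ < i₁) (d₁₃ : j₁ < i₃ ∨ j₃ < i₁) (d₂₃ : j₂ < i₃ ∨ j₃ < i₂)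
    (hcov : ∀ k, s ≤ k → k < s + m → i₁ ≤ k ∧ k ≤ j₁ ∨ i₂ ≤ k ∧ k ≤ j₂ ∨ i₃ ≤ k ∧ k ≤ j₃) :
    ¬ Bridge G c a₁ b₃ := by
  obtain ⟨w₁, w₂, w₃, w₄, w₅, w₆⟩ := hw
  refine hmax.not_bridge ((h₁.append h₁₂ h₂ (hc.disjoint_image w₁ w₂ w₃ w₄ d₁₂)).append h₂₃ h₃
    (Finset.disjoint_union_left.2 ⟨hc.disjoint_image w₁ w₂ w₅ w₆ d₁₃,
      hc.disjoint_image w₃ w₄ w₅ w₆ d₂₃⟩)) ?_ (hc.forall_of_window (p := fun x => x ∈ _) s fun k hk hk' => ?_)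
  · intro x hx
    simp only [Finset.mem_union, Finset.mem_image] at hx
    rcases hx with (⟨k, -, rfl⟩ | ⟨k, -, rfl⟩) | ⟨k, -, rfl⟩ <;> exact ⟨k, rfl⟩
  · simp only [Finset.mem_union, Finset.mem_image, Finset.mem_Icc]
    rcases hcov k hk hk' with h | h | h
    · exact Or.inl (Or.inl ⟨k, h, rfl⟩)
    · exact Or.inl (Or.inr ⟨k, h, rfl⟩)
    · exact Or.inr ⟨k, h, rfl⟩

end CycleIndex

end Rerouting

/-- `x` and `y` lie in the same component of the graph obtained by deleting the values of `c`. -/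
def Linked {V : Type*} (G : SimpleGraph V) (c : ℤ → V) (x y : V) : Prop :=
  ∃ (hx : ∀ k, c k ≠ x) (hy : ∀ k, c k ≠ y),
    (G.induce {v | ∀ k, c k ≠ v}).Reachable ⟨x, hx⟩ ⟨y, hy⟩

namespace Linked

variable {V : Type*} {G : SimpleGraph V} {c : ℤ → V}

theorem trans_adj {x y z : V} (h : Linked G c x y) (hyz : G.Adj y z) (hz : ∀ k, c k ≠ z) :
    Linked G c x z := by
  obtain ⟨hx, hy, h⟩ := h
  exact ⟨hx, hz, h.trans (Adj.reachable (by simpa using hyz))⟩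

theorem bridge [DecidableEq V] {x y z u v : V} (hy : Linked G c x y) (hz : Linked G c x z)
    (hu : G.Adj u y) (hv : G.Adj v z) : Bridge G c u v := by
  obtain ⟨hx, hy, h⟩ := hy
  obtain ⟨_, hz, h'⟩ := hz
  obtain ⟨S, hS, hoff⟩ := PathOn.exists_of_reachable_induce (h.symm.trans h')
  exact ⟨S, y, z, hS, hoff, hu, hv.symm⟩

end Linked

namespace CycleIndex

variable {V : Type*} [Fintype V] {G : SimpleGraph V} {c : ℤ → V} {m : ℤ}

/-- In a 3-connected graph, every component left by deleting a cycle has neighbours on the cycle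
other than any two prescribed vertices. -/
theorem exists_attachment (hc : CycleIndex G c m) (h3 : ThreeConnected G) {x₀ : V}
    (hx₀ : ∀ k, c k ≠ x₀) (p q : V) (hp : x₀ ≠ p) (hq : x₀ ≠ q) :
    ∃ i x, c i ≠ p ∧ c i ≠ q ∧ Linked G c x₀ x ∧ G.Adj (c i) x := by
  by_contra! hno
  obtain ⟨k, hkp, hkq⟩ : ∃ k, c k ≠ p ∧ c k ≠ q := by
    have hm := hc.three_le
    have h01 := hc.ne_of_lt (i := 0) (j := 1) (by omega) (by omega)
    have h02 := hc.ne_of_lt (i := 0) (j := 2) (by omega) (by omega)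
    have h12 := hc.ne_of_lt (i := 1) (j := 2) (by omega) (by omega)
    by_contra! h
    have h0 := h 0
    have h1 := h 1
    have h2 := h 2
    by_cases e0 : c 0 = p <;> by_cases e1 : c 1 = p <;> grind
  obtain ⟨w⟩ := (h3.2 p q).preconnected ⟨x₀, hp, hq⟩ ⟨c k, hkp, hkq⟩
  have key : ∀ (a b : {w | w ≠ p ∧ w ≠ q}) (w : (G.induce {w | w ≠ p ∧ w ≠ q}).Walk a b),
      Linked G c x₀ a → Linked G c x₀ b := by
    intro a b w
    induction w with
    | nil => exact id
    | @cons a b d hab w ih =>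
      refine fun ha => ih (ha.trans_adj (by simpa using hab) ?_)
      intro k hk
      exact hno k a (hk ▸ b.2.1) (hk ▸ b.2.2) ha (by rw [hk]; simpa using hab.symm)
  obtain ⟨-, h, -⟩ := key _ _ w ⟨hx₀, hx₀, Reachable.refl _⟩
  exact h k rfl

variable [DecidableEq V]

theorem forall_eq_of_claw_free_off_clique (hc : CycleIndex G c m) (h3 : ThreeConnected G)
    {H : V → Prop} (hclique : ∀ u v, H u → H v → u ≠ v → G.Adj u v)
    (hclaw : ∀ x a b d, IsInducedClaw G x a b d → H a ∨ H b ∨ H d)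
    (hdist : ∀ u v w, u ≠ v → ¬ G.Adj u v → G.Adj u w → G.Adj w v →
      H u ∨ H v ∨ ∃ w', w' ≠ w ∧ G.Adj u w' ∧ G.Adj w' v)
    (hH : ∀ v, H v → ∃ k, c k = v) (hmax : IsMaximalCycle G c) (x₀ : V) : ∃ k, c k = x₀ := by
  by_contra! hx₀
  have hm := hc.three_le
  set Att : V → ℤ → Prop := fun x i => Linked G c x₀ x ∧ G.Adj (c i) x with hAtt
  have hbr : ∀ {x y i j}, Att x i → Att y j → Bridge G c (c i) (c j) :=
    fun h h' => h.1.bridge h'.1 h.2 h'.2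
  have hoff : ∀ {x i}, Att x i → ∀ k, c k ≠ x := fun h => h.1.2.1
  have hoffH : ∀ {x i}, Att x i → ¬ H x := fun h hx => by
    obtain ⟨k, hk⟩ := hH _ hx
    exact hoff h k hk
  have hsucc : ∀ {x i}, Att x i → ∀ y, ¬ Att y (i + 1) := fun h y hy =>
    hc.not_bridge_succ hmax _ (hbr hy h)
  have hpred : ∀ {x i}, Att x i → ∀ y, ¬ Att y (i - 1) := fun h y hy =>
    hsucc hy _ (by simpa using h)
  have hcongr : ∀ {x i j}, Att x i → c j = c i → Att x j := fun h he => ⟨h.1, he ▸ h.2⟩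
  have hsucc2 : ∀ {x y i j}, Att x i → Att y j → c i ≠ c j →
      c (i + 1) ≠ c (j + 1) ∧ ¬ G.Adj (c (i + 1)) (c (j + 1)) := by
    intro x y i j hx hy hne
    refine ⟨fun h => hne ?_, ?_⟩
    · rw [hc.eq_iff] at h ⊢
      simpa using h
    obtain ⟨l, hl, hl', he⟩ := hc.exists_eq_of_window i j
    have h0 := he 0
    simp only [add_zero] at h0
    have : l ≠ i := by rintro rfl; exact hne h0
    rw [← he 1]
    exact hc.not_adj_succ_of_bridge hmax (by omega) hl' (hbr (hcongr hy h0) hx)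
  have hpred2 : ∀ {x y i j}, Att x i → Att y j → c i ≠ c j →
      c (i - 1) ≠ c (j - 1) ∧ ¬ G.Adj (c (i - 1)) (c (j - 1)) := by
    intro x y i j hx hy hne
    refine ⟨fun h => hne ?_, ?_⟩
    · rw [hc.eq_iff] at h ⊢
      simpa using h
    obtain ⟨l, hl, hl', he⟩ := hc.exists_eq_of_window i j
    have h0 := he 0
    have h1 := he (-1)
    simp only [add_zero, ← sub_eq_add_neg] at h0 h1
    have : l ≠ i := by rintro rfl; exact hne h0
    rw [← h1]
    exact hc.not_adj_pred_of_bridge hmax (by omega) hl' (hbr (hcongr hy h0) hx)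
  have hsuccH : ∀ {x y i j}, Att x i → Att y j → H (c (i + 1)) → H (c (j + 1)) → c i = c j := by
    intro x y i j hx hy h h'
    by_contra hne
    obtain ⟨h1, h2⟩ := hsucc2 hx hy hne
    exact h2 (hclique _ _ h h' h1)
  have hpredH : ∀ {x y i j}, Att x i → Att y j → H (c (i - 1)) → H (c (j - 1)) → c i = c j := by
    intro x y i j hx hy h h'
    by_contra hne
    obtain ⟨h1, h2⟩ := hpred2 hx hy hne
    exact h2 (hclique _ _ h h' h1)
  have hadj' : ∀ i, G.Adj (c i) (c (i - 1)) := fun i => by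
    have := (hc.adj (i - 1)).symm
    rwa [sub_add_cancel] at this
  -- the second common neighbour of `x` and a light vertex next to an attachment
  have hshi : ∀ {x i e}, Att x i → G.Adj (c i) (c e) → (∀ y, ¬ Att y e) → ¬ H (c e) →
      ∃ k, c k ≠ c i ∧ Att x k ∧ G.Adj (c k) (c e) := by
    intro x i e hx hie he hHe
    obtain h | h | ⟨w, hwi, hxw, hwe⟩ := hdist x (c e) (c i) (hoff hx e).symm
      (fun h => he x ⟨hx.1, h.symm⟩) hx.2.symm hie
    · exact absurd h (hoffH hx)
    · exact absurd h hHe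
    · by_cases hw : ∃ k, c k = w
      · obtain ⟨k, rfl⟩ := hw
        exact ⟨k, hwi, ⟨hx.1, hxw.symm⟩, hwe⟩
      · push Not at hw
        exact absurd ⟨hx.1.trans_adj hxw hw, hwe.symm⟩ (he w)
  -- an attachment both of whose neighbours on the cycle are light
  obtain ⟨i, x, hx, his, hip⟩ : ∃ i x, Att x i ∧ ¬ H (c (i + 1)) ∧ ¬ H (c (i - 1)) := by
    have hp : ∃ p, p ≠ x₀ ∧ ∀ i x, Att x i → H (c (i + 1)) → c i = p := by
      by_cases h : ∃ i x, Att x i ∧ H (c (i + 1))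
      · obtain ⟨i, x, hx, hi⟩ := h
        exact ⟨c i, hx₀ i, fun j y hy hj => hsuccH hy hx hj hi⟩
      · push Not at h
        exact ⟨c 0, hx₀ 0, fun j y hy hj => absurd hj (h j y hy)⟩
    have hq : ∃ p, p ≠ x₀ ∧ ∀ i x, Att x i → H (c (i - 1)) → c i = p := by
      by_cases h : ∃ i x, Att x i ∧ H (c (i - 1))
      · obtain ⟨i, x, hx, hi⟩ := h
        exact ⟨c i, hx₀ i, fun j y hy hj => hpredH hy hx hj hi⟩
      · push Not at h
        exact ⟨c 0, hx₀ 0, fun j y hy hj => absurd hj (h j y hy)⟩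
    obtain ⟨p, hp0, hp⟩ := hp
    obtain ⟨q, hq0, hq⟩ := hq
    obtain ⟨i, x, hip, hiq, hx, hix⟩ := hc.exists_attachment h3 hx₀ p q hp0.symm hq0.symm
    exact ⟨i, x, ⟨hx, hix⟩, fun h => hip (hp i x ⟨hx, hix⟩ h), fun h => hiq (hq i x ⟨hx, hix⟩ h)⟩
  have hxs : ∀ {j}, Att x j → ¬ G.Adj x (c (j + 1)) := fun h h' => hsucc h x ⟨h.1, h'.symm⟩
  have hxp : ∀ {j}, Att x j → ¬ G.Adj x (c (j - 1)) := fun h h' => hpred h x ⟨h.1, h'.symm⟩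
  have hlink : G.Adj (c (i - 1)) (c (i + 1)) := by
    by_contra hn
    have := hclaw (c i) x (c (i - 1)) (c (i + 1)) ⟨(hoff hx _).symm, (hoff hx _).symm,
      hc.ne_of_lt (by omega) (by omega), hx.2, hadj' i, hc.adj i, hxp hx, hxs hx, hn⟩
    exact this.elim (hoffH hx) (Or.elim · hip his)
  have hwin : ∀ {j}, Att x j → c j ≠ c i → ∃ l, i < l ∧ l < i + m ∧ ∀ d, c (l + d) = c (j + d) := by
    intro j hj hne
    obtain ⟨l, hl, hl', he⟩ := hc.exists_eq_of_window i j
    refine ⟨l, lt_of_le_of_ne hl ?_, hl', he⟩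
    rintro rfl
    exact hne (by simpa using (he 0).symm)
  obtain ⟨j, hij, hjm, hj, hjH, hji⟩ : ∃ j, i < j ∧ j < i + m ∧ Att x j ∧ H (c (j + 1)) ∧
      G.Adj (c j) (c (i + 1)) := by
    obtain ⟨j', hne, hj', hadj⟩ := hshi hx (hc.adj i) (hsucc hx) his
    obtain ⟨j, hij, hjm, he⟩ := hwin hj' hne
    have h0 : c j = c j' := by simpa using he 0
    have hj := hcongr hj' h0
    rw [← h0] at hne hadj
    obtain ⟨n1, n2⟩ := hsucc2 hj hx hne
    have := hclaw (c j) x (c (j + 1)) (c (i + 1)) ⟨(hoff hx _).symm, (hoff hx _).symm, n1,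
      hj.2, hc.adj j, hadj, hxs hj, hxs hx, n2⟩
    exact ⟨j, hij, hjm, hj, (this.resolve_left (hoffH hx)).resolve_right his, hadj⟩
  obtain ⟨k, hik, hkm, hk, hkH, hki⟩ : ∃ k, i < k ∧ k < i + m ∧ Att x k ∧ H (c (k - 1)) ∧
      G.Adj (c k) (c (i - 1)) := by
    obtain ⟨j', hne, hj', hadj⟩ := hshi hx (hadj' i) (hpred hx) hip
    obtain ⟨j, hij, hjm, he⟩ := hwin hj' hne
    have h0 : c j = c j' := by simpa using he 0
    have hj := hcongr hj' h0
    rw [← h0] at hne hadj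
    obtain ⟨n1, n2⟩ := hpred2 hj hx hne
    have := hclaw (c j) x (c (j - 1)) (c (i - 1)) ⟨(hoff hx _).symm, (hoff hx _).symm, n1,
      hj.2, hadj' j, hadj, hxp hj, hxp hx, n2⟩
    exact ⟨j, hij, hjm, hj, (this.resolve_left (hoffH hx)).resolve_right hip, hadj⟩
  have hj1 : j ≠ i + 1 := by rintro rfl; exact hsucc hx _ hj
  have hi1 : j + 1 ≠ i + m := fun h => hsucc hj x (by rw [h]; exact hcongr hx (hc.add_period i))
  have hk1 : k ≠ i + 1 := by rintro rfl; exact hsucc hx _ hk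
  have hpm : c (i - 1) = c (i + m - 1) := by
    rw [← hc.add_period (i - 1)]
    congr 1; ring
  rcases lt_trichotomy j k with hjk | rfl | hkj
  · have hjp : ¬ H (c (j - 1)) := fun h =>
      hc.ne_of_lt hjk (by omega) (hpredH hj hk h hkH)
    obtain ⟨l, hlj, hl, hladj⟩ := hshi hj (hadj' j) (hpred hj) hjp
    by_cases hli : c l = c i
    · rw [hli] at hladj
      exact hc.not_bridge_of_three_paths hmax (s := i)
        (hc.pathOn (i := j) (j := i + m - 1) (by omega) (by omega))
        (hc.pathOn (i := i + 1) (j := j - 1) (by omega) (by omega))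
        (hc.pathOn (i := i) (j := i) le_rfl (by omega))
        (hpm ▸ hlink) hladj.symm (by omega) (by omega) (by omega) (by omega) (by intros; omega)
        (hbr hj hx)
    · by_cases hlk : c l = c k
      · rw [hlk] at hladj
        obtain ⟨n1, n2⟩ := hpred2 hx hj (hc.ne_of_lt hij hjm)
        have := hclaw (c k) x (c (i - 1)) (c (j - 1)) ⟨(hoff hx _).symm, (hoff hx _).symm, n1,
          hk.2, hki, hladj, hxp hx, hxp hj, n2⟩
        exact this.elim (hoffH hx) (Or.elim · hip hjp)
      · obtain ⟨n1, n2⟩ := hpred2 hl hj hlj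
        have := hclaw (c l) x (c (l - 1)) (c (j - 1)) ⟨(hoff hx _).symm, (hoff hx _).symm, n1,
          hl.2, hadj' l, hladj, hxp hl, hxp hj, n2⟩
        exact this.elim (hoffH hx) (Or.elim · (fun h => hlk (hpredH hl hk h hkH)) hjp)
  · have h1 : G.Adj (c (j - 1)) (c (j + 1)) :=
      hclique _ _ hkH hjH (hc.ne_of_lt (by omega) (by omega))
    exact hc.not_bridge_of_three_paths hmax (s := i + 1)
      (hc.pathOn (i := j) (j := j) le_rfl (by omega))
      (hc.pathOn (i := i + 1) (j := j - 1) (by omega) (by omega))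
      (hc.pathOn (i := j + 1) (j := i + m) (by omega) (by omega))
      hji h1 (by omega) (by omega) (by omega) (by omega) (by intros; omega)
      (by rw [hc.add_period]; exact hbr hj hx)
  · have h1 : G.Adj (c (k - 1)) (c (j + 1)) :=
      hclique _ _ hkH hjH (hc.ne_of_lt (by omega) (by omega))
    exact hc.not_bridge_of_three_paths hmax (s := i)
      (hc.pathOn (i := i) (j := k - 1) (by omega) (by omega))
      (hc.pathOn (i := j + 1) (j := i + m - 1) (by omega) (by omega))
      (hc.pathOn (i := k) (j := j) (by omega) (by omega))
      h1 (hpm ▸ hki.symm) (by omega) (by omega) (by omega) (by omega) (by intros; omega)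
      (hbr hx hj)

end CycleIndex

theorem PathOn.exists_of_isClique {V : Type*} [DecidableEq V] {G : SimpleGraph V} {S : Finset V}
    (hS : S.Nonempty) (h : G.IsClique S) : ∃ u v, PathOn G S u v := by
  induction hS using Finset.Nonempty.cons_induction with
  | singleton a => exact ⟨a, a, .single a⟩
  | cons a S ha hS ih =>
    obtain ⟨u, v, huv⟩ := ih (h.subset (by simp))
    rw [Finset.cons_eq_insert]
    refine ⟨a, v, .cons (h (by simp) (by simp [huv.left_mem]) ?_) ha huv⟩
    rintro rfl
    exact ha huv.left_mem

namespace ThreeConnected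

variable {V : Type*} [Fintype V] {G : SimpleGraph V}

theorem mono {G' : SimpleGraph V} (h3 : ThreeConnected G) (hle : G ≤ G') : ThreeConnected G' :=
  ⟨h3.1, fun u v => (h3.2 u v).mono fun _ _ h => hle h⟩

theorem exists_adj_ne (h3 : ThreeConnected G) {u v : V} (huv : u ≠ v) :
    ∃ t, t ≠ v ∧ G.Adj u t := by
  classical
  have hcard : ({u, v} : Finset V).card < (Finset.univ : Finset V).card := by
    have := Finset.card_le_two (a := u) (b := v)
    have := h3.1
    rw [Finset.card_univ]
    omega
  obtain ⟨s, -, hs⟩ := Finset.exists_mem_notMem_of_card_lt_card hcard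
  simp only [Finset.mem_insert, Finset.mem_singleton, not_or] at hs
  obtain ⟨w⟩ := (h3.2 v v).preconnected ⟨u, huv, huv⟩ ⟨s, hs.2, hs.2⟩
  generalize hb : (⟨s, hs.2, hs.2⟩ : {w | w ≠ v ∧ w ≠ v}) = b at w
  cases w with
  | nil => exact absurd (congrArg Subtype.val hb) hs.1
  | @cons _ t _ h _ => exact ⟨t, t.2.1, by simpa using h⟩

variable [DecidableEq V]

theorem exists_cycle_of_adj (h3 : ThreeConnected G) {u v : V} (huv : G.Adj u v) :
    ∃ S a b, PathOn G S a b ∧ G.Adj b a ∧ 3 ≤ S.card ∧ u ∈ S ∧ v ∈ S := by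
  obtain ⟨t, htv, hut⟩ := h3.exists_adj_ne huv.ne
  obtain ⟨S, hS, hSu⟩ := PathOn.exists_of_reachable_induce
    ((h3.2 u u).preconnected ⟨t, hut.ne', hut.ne'⟩ ⟨v, huv.ne', huv.ne'⟩)
  have hu : u ∉ S := fun h => (hSu u h).1 rfl
  have hv : v ∈ S := hS.symm.left_mem
  refine ⟨_, _, _, hS.cons hut hu, huv.symm, ?_, by simp, by simp [hv]⟩
  rw [Finset.card_insert_of_notMem hu]
  have := Finset.one_lt_card.2 ⟨t, hS.left_mem, v, hv, htv⟩
  omega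

theorem exists_cycle_of_isClique (h3 : ThreeConnected G) {K : Finset V} (hK : G.IsClique K) :
    ∃ S a b, PathOn G S a b ∧ G.Adj b a ∧ 3 ≤ S.card ∧ K ⊆ S := by
  have hcard := h3.1
  have : Nontrivial V := Fintype.one_lt_card_iff_nontrivial.1 (by omega)
  rcases lt_or_ge K.card 3 with h | h
  · obtain ⟨u, v, huv, hKuv⟩ : ∃ u v, G.Adj u v ∧ K ⊆ {u, v} := by
      have hnbr : ∀ u, ∃ v, G.Adj u v := fun u => by
        obtain ⟨v, hv⟩ := exists_ne u
        obtain ⟨t, -, ht⟩ := h3.exists_adj_ne hv.symm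
        exact ⟨t, ht⟩
      have hcases : K.card = 0 ∨ K.card = 1 ∨ K.card = 2 := by omega
      rcases hcases with h | h | h
      · rw [Finset.card_eq_zero] at h
        obtain ⟨u, -⟩ := exists_pair_ne V
        obtain ⟨v, hv⟩ := hnbr u
        exact ⟨u, v, hv, by simp [h]⟩
      · obtain ⟨u, rfl⟩ := Finset.card_eq_one.1 h
        obtain ⟨v, hv⟩ := hnbr u
        exact ⟨u, v, hv, by simp⟩
      · obtain ⟨u, v, hne, rfl⟩ := Finset.card_eq_two.1 h
        exact ⟨u, v, hK (by simp) (by simp) hne, Finset.Subset.refl _⟩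
    obtain ⟨S, a, b, hS, hba, h3S, hu, hv⟩ := h3.exists_cycle_of_adj huv
    exact ⟨S, a, b, hS, hba, h3S, hKuv.trans (by simp [Finset.insert_subset_iff, hu, hv])⟩
  · obtain ⟨u, hu⟩ : K.Nonempty := Finset.card_pos.1 (by omega)
    have hne : (K.erase u).Nonempty := Finset.card_pos.1 (by rw [Finset.card_erase_of_mem hu]; omega)
    obtain ⟨a, b, hab⟩ := PathOn.exists_of_isClique hne (hK.subset (by simp))
    have ha := Finset.mem_erase.1 hab.left_mem
    have hb := Finset.mem_erase.1 hab.symm.left_mem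
    refine ⟨K, u, b, ?_, hK hb.2 hu hb.1, h, Finset.Subset.refl _⟩
    rw [← Finset.insert_erase hu]
    exact hab.cons (hK hu ha.2 ha.1.symm) (Finset.notMem_erase u K)

/-- The case of the theorem where the set `H` of heavy vertices is a clique. -/
theorem hasSpanningCycle_of_clique (h3 : ThreeConnected G)
    {H : V → Prop} (hclique : ∀ u v, H u → H v → u ≠ v → G.Adj u v)
    (hclaw : ∀ x a b d, IsInducedClaw G x a b d → H a ∨ H b ∨ H d)
    (hdist : ∀ u v w, u ≠ v → ¬ G.Adj u v → G.Adj u w → G.Adj w v →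
      H u ∨ H v ∨ ∃ w', w' ≠ w ∧ G.Adj u w' ∧ G.Adj w' v) : HasSpanningCycle G := by
  classical
  let C : Finset V → Prop := fun S => ∃ a b, PathOn G S a b ∧ G.Adj b a ∧ 3 ≤ S.card ∧
    ∀ v, H v → v ∈ S
  have hC : (Finset.univ.filter C).Nonempty := by
    obtain ⟨S, a, b, hS, hba, h3S, hK⟩ := h3.exists_cycle_of_isClique (K := Finset.univ.filter H)
      fun u hu v hv hne => hclique u v (by simpa using hu) (by simpa using hv) hne
    exact ⟨S, by simpa [C] using ⟨a, b, hS, hba, h3S, fun v hv => hK (by simpa using hv)⟩⟩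
  obtain ⟨S, hS, hmax⟩ := Finset.exists_max_image _ Finset.card hC
  obtain ⟨a, b, hab, hba, h3S, hHS⟩ := (Finset.mem_filter.1 hS).2
  obtain ⟨c, hc, hmem⟩ := CycleIndex.of_pathOn hab hba h3S
  have hmaxc : IsMaximalCycle G c := by
    intro T u v huv hvu hcT x hx
    have hST : S ⊆ T := fun y hy => by
      obtain ⟨k, rfl⟩ := (hmem y).1 hy
      exact hcT k
    have hTS := hmax T (Finset.mem_filter.2 ⟨Finset.mem_univ _, u, v, huv, hvu,
      h3S.trans (Finset.card_le_card hST), fun y hy => hST (hHS y hy)⟩)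
    rw [← hmem, Finset.eq_of_subset_of_card_le hST hTS]
    exact hx
  have huniv : S = Finset.univ := Finset.eq_univ_iff_forall.2 fun x => (hmem x).2
    (hc.forall_eq_of_claw_free_off_clique h3 hclique hclaw hdist
      (fun v hv => (hmem v).1 (hHS v hv)) hmaxc x)
  exact ⟨a, b, huniv ▸ hab, hba⟩

end ThreeConnected

/-- **Broersma–Ryjáček–Schiermeyer theorem.** A 3-connected 1-heavy graph in
which every pair of vertices at distance 2 satisfies Fan's or Shi's condition
is Hamiltonian. -/
theorem brs_one_heavy {V : Type*} [Fintype V] [DecidableEq V]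
    (G : SimpleGraph V) [DecidableRel G.Adj]
    (h3 : ThreeConnected G)
    (hheavy : OneHeavy G)
    (h : ∀ u v : V, G.dist u v = 2 → FanOrShi G u v) :
    G.IsHamiltonian := by
  classical
  have hV : 3 ≤ Fintype.card V := le_trans (by norm_num) h3.1
  set G' := G ⊔ SimpleGraph.fromRel fun u v => Heavy G u ∧ Heavy G v with hG'
  have hadj : ∀ u v, G'.Adj u v ↔ G.Adj u v ∨ u ≠ v ∧ Heavy G u ∧ Heavy G v := by
    intro u v
    simp only [hG', sup_adj, fromRel_adj]
    tauto
  have hle : G ≤ G' := le_sup_left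
  refine (HasSpanningCycle.of_le hV hle ?_ (h3.mono hle |>.hasSpanningCycle_of_clique
    (H := Heavy G) ?_ ?_ ?_)).isHamiltonian hV
  · intro u v huv hn
    obtain ⟨-, hu, hv⟩ := ((hadj u v).1 huv).resolve_left hn
    unfold Heavy at hu hv
    omega
  · exact fun u v hu hv hne => (hadj u v).2 (Or.inr ⟨hne, hu, hv⟩)
  · rintro x a b d ⟨hab, had, hbd, hxa, hxb, hxd, nab, nad, nbd⟩
    rw [hadj] at hxa hxb hxd
    rcases hxa with hxa | ⟨-, -, ha⟩
    · rcases hxb with hxb | ⟨-, -, hb⟩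
      · rcases hxd with hxd | ⟨-, -, hd⟩
        · exact hheavy x a b d ⟨hab, had, hbd, hxa, hxb, hxd, fun h => nab (hle h),
            fun h => nad (hle h), fun h => nbd (hle h)⟩
        · exact Or.inr (Or.inr hd)
      · exact Or.inr (Or.inl hb)
    · exact Or.inl ha
  · intro u v w hne hn huw hwv
    rw [hadj] at huw hwv
    rcases huw with huw | ⟨-, hu, -⟩
    · rcases hwv with hwv | ⟨-, -, hv⟩
      · have hn' : ¬ G.Adj u v := fun h => hn (hle h)
        have hdist : G.dist u v = 2 := by
          have hle := dist_le (Walk.cons huw (Walk.cons hwv Walk.nil))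
          have hlt := (huw.reachable.trans hwv.reachable).one_lt_dist_of_ne_of_not_adj hne hn'
          simp at hle
          omega
        rcases h u v hdist with hu | hv | hc
        · exact Or.inl hu
        · exact Or.inr (Or.inl hv)
        · obtain ⟨w', hw', hne'⟩ := Finset.exists_mem_ne hc w
          simp only [Finset.mem_inter, mem_neighborFinset] at hw'
          exact Or.inr (Or.inr ⟨w', hne', hle hw'.1, hle hw'.2.symm⟩)
      · exact Or.inr (Or.inl hv)
    · exact Or.inl hu
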